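/- Let A be a complete finitely ambiguous NBW with a fixed enumeration of its states and let w be an ω-word. Then the reduced run DAG Ḡ of A over w has at most |Q| distinct ω-branches starting at level 0, where an ω-branch starting at level 0 is an infinite sequence of vertices (q_0, 0)(q_1, 1)(q_2, 2)… in which consecutive vertices are joined by edges of Ḡ. -/

import Mathlib

open scoped Classical

/-- A nondeterministic Büchi automaton on ω-words with states `Q` over alphabet `σ`. -/
structure NBW (σ : Type) (Q : Type) where
  init : Set Q
  trans : Q → σ → Set Q
  acc : Set Q

namespace NBW

variable {σ Q : Type}

/-- `ρ` is a run of `A` on the ω-word `w`. -/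
def IsRun (A : NBW σ Q) (w : ℕ → σ) (ρ : ℕ → Q) : Prop :=
  ρ 0 ∈ A.init ∧ ∀ i, ρ (i + 1) ∈ A.trans (ρ i) (w i)

/-- `ρ` is an accepting run of `A` on `w`: it visits `A.acc` infinitely often. -/
def IsAccRun (A : NBW σ Q) (w : ℕ → σ) (ρ : ℕ → Q) : Prop :=
  A.IsRun w ρ ∧ ∀ n, ∃ m, n ≤ m ∧ ρ m ∈ A.acc

/-- The ω-language accepted by `A`. -/
def Lang (A : NBW σ Q) : Set (ℕ → σ) := {w | ∃ ρ, A.IsAccRun w ρ}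

/-- `A` is complete: every state has a successor on every letter. -/
def Complete (A : NBW σ Q) : Prop := ∀ q a, (A.trans q a).Nonempty

/-- `A` is finitely ambiguous: every accepted word has finitely many accepting runs. -/
def FinitelyAmbiguous (A : NBW σ Q) : Prop :=
  ∀ w ∈ A.Lang, {ρ | A.IsAccRun w ρ}.Finite

/-- `A` is limit deterministic with partition `(QN, QD)`. -/
def LimitDetPart (A : NBW σ Q) (QN QD : Set Q) : Prop :=
  Disjoint QN QD ∧ QN ∪ QD = Set.univ ∧ A.acc ⊆ QD ∧
    ∀ q ∈ QD, ∀ a, ∃ q' ∈ QD, A.trans q a = {q'}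

/-- `A` is limit deterministic (for some partition). -/
def LimitDet (A : NBW σ Q) : Prop := ∃ QN QD, A.LimitDetPart QN QD

end NBW

namespace NBW

variable {σ Q : Type}

/-- The set of successors of the set `S` under letter `b`. -/
def dSet (A : NBW σ Q) (S : Set Q) (b : σ) : Set Q := ⋃ q ∈ S, A.trans q b

/-- The set of states occurring at level `ℓ` of the run DAG of `A` over `w`. -/
def levelSet (A : NBW σ Q) (w : ℕ → σ) : ℕ → Set Q
  | 0 => A.init
  | ℓ + 1 => A.dSet (levelSet A w ℓ) (w ℓ)

/-- Edge of the run DAG `G` of `A` over `w` from vertex `(q, ℓ)` to vertex `(q', ℓ+1)`. -/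
def GEdge (A : NBW σ Q) (w : ℕ → σ) (q : Q) (ℓ : ℕ) (q' : Q) : Prop :=
  q ∈ A.levelSet w ℓ ∧ q' ∈ A.trans q (w ℓ)

/-- Edge of the reduced run DAG `Ḡ` of `A` over `w` (wrt the fixed enumeration given
by the linear order on `Q`) from vertex `(q, ℓ)` to vertex `(q', ℓ+1)`:
`q` is the minimal state of level `ℓ` having `q'` as a successor. -/
def RedEdge (A : NBW σ Q) [LinearOrder Q] (w : ℕ → σ) (q : Q) (ℓ : ℕ) (q' : Q) : Prop :=
  q ∈ A.levelSet w ℓ ∧ q' ∈ A.trans q (w ℓ) ∧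
    ∀ p ∈ A.levelSet w ℓ, q' ∈ A.trans p (w ℓ) → q ≤ p

/-- `γ` is an initial ω-branch of the level-indexed DAG with edge relation `E`:
`γ ℓ` is the state of the branch vertex at level `ℓ`. -/
def IsInitOmegaBranch (A : NBW σ Q) (E : Q → ℕ → Q → Prop) (γ : ℕ → Q) : Prop :=
  γ 0 ∈ A.init ∧ ∀ ℓ, E (γ ℓ) ℓ (γ (ℓ + 1))

/-- The branch `γ` is accepting: it visits `F`-vertices infinitely often. -/
def IsAcceptingBranch (A : NBW σ Q) (γ : ℕ → Q) : Prop :=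
  ∀ n, ∃ m, n ≤ m ∧ γ m ∈ A.acc

/-- There is an infinite branch from vertex `(q, ℓ)` inside the sub-DAG with vertex
predicate `P` and edge relation `E`. -/
def SubInfBranch (P : Q → ℕ → Prop) (E : Q → ℕ → Q → Prop) (q : Q) (ℓ : ℕ) : Prop :=
  ∃ γ : ℕ → Q, γ 0 = q ∧ (∀ i, P (γ i) (ℓ + i)) ∧ ∀ i, E (γ i) (ℓ + i) (γ (i + 1))

/-- Vertex `(q', ℓ')` is reachable from vertex `(q, ℓ)` inside the sub-DAG with
vertex predicate `P` and edge relation `E`. -/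
def SubReach (P : Q → ℕ → Prop) (E : Q → ℕ → Q → Prop)
    (q : Q) (ℓ : ℕ) (q' : Q) (ℓ' : ℕ) : Prop :=
  ∃ n, ∃ γ : ℕ → Q, γ 0 = q ∧ γ n = q' ∧ ℓ' = ℓ + n ∧
    (∀ i ≤ n, P (γ i) (ℓ + i)) ∧ ∀ i < n, E (γ i) (ℓ + i) (γ (i + 1))

/-- Vertex `(q, ℓ)` is `F`-free in the sub-DAG with vertex predicate `P` and edge
relation `E`: it is not finite and no `F`-vertex is reachable from it. -/
def FFreeVtx (A : NBW σ Q) (P : Q → ℕ → Prop) (E : Q → ℕ → Q → Prop)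
    (q : Q) (ℓ : ℕ) : Prop :=
  SubInfBranch P E q ℓ ∧ ∀ q' ℓ', SubReach P E q ℓ q' ℓ' → q' ∉ A.acc

/-- The pruning sequence of the DAG with vertex predicate `P0` and edge relation `E`:
odd steps remove the finite vertices, even steps remove the `F`-free vertices,
everything being evaluated in the current graph. -/
def pruneSeq (A : NBW σ Q) (E : Q → ℕ → Q → Prop) (P0 : Q → ℕ → Prop) :
    ℕ → Q → ℕ → Prop
  | 0 => P0
  | i + 1 =>
    if i % 2 = 0 then
      fun q ℓ => pruneSeq A E P0 i q ℓ ∧ SubInfBranch (pruneSeq A E P0 i) E q ℓ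
    else
      fun q ℓ => pruneSeq A E P0 i q ℓ ∧ ¬ A.FFreeVtx (pruneSeq A E P0 i) E q ℓ

end NBW

/-- The reduced run DAG `Ḡ` of a complete FANBW `A` over `w` has at most `|Q|`
distinct ω-branches starting at level `0`. -/
theorem NBW.reduced_dag_branch_bound (σ Q : Type) [Fintype σ] [Nonempty σ]
    [Fintype Q] [LinearOrder Q] (A : NBW σ Q)
    (hc : A.Complete) (hfa : A.FinitelyAmbiguous) (w : ℕ → σ) :
    {γ : ℕ → Q | γ 0 ∈ A.levelSet w 0 ∧
        ∀ ℓ, A.RedEdge w (γ ℓ) ℓ (γ (ℓ + 1))}.Finite ∧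
    {γ : ℕ → Q | γ 0 ∈ A.levelSet w 0 ∧
        ∀ ℓ, A.RedEdge w (γ ℓ) ℓ (γ (ℓ + 1))}.ncard ≤ Fintype.card Q := by
  set S := {γ : ℕ → Q | γ 0 ∈ A.levelSet w 0 ∧
        ∀ ℓ, A.RedEdge w (γ ℓ) ℓ (γ (ℓ + 1))} with hS
  -- two branches that meet at level `n` agree at all levels up to `n`
  have back : ∀ γ ∈ S, ∀ γ' ∈ S, ∀ n m, γ (m + n) = γ' (m + n) → γ m = γ' m := by
    intro γ hγ γ' hγ' n
    induction n with
    | zero => intro m h; exact h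
    | succ n ih =>
      intro m h
      apply ih
      have h1 := hγ.2 (m + n)
      have h2 := hγ'.2 (m + n)
      have h' : γ (m + n + 1) = γ' (m + n + 1) := h
      rw [← h'] at h2
      exact le_antisymm (h1.2.2 _ h2.1 h2.2.1) (h2.2.2 _ h1.1 h1.2.1)
  have key : ∀ T : Finset (ℕ → Q), (T : Set (ℕ → Q)) ⊆ S → T.card ≤ Fintype.card Q := by
    intro T hT
    have hev : ∀ᶠ n in Filter.atTop, ∀ γ ∈ T, ∀ γ' ∈ T, γ n = γ' n → γ = γ' := by
      rw [Filter.eventually_all_finset]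
      intro γ hγ
      rw [Filter.eventually_all_finset]
      intro γ' hγ'
      by_cases heq : γ = γ'
      · exact Filter.Eventually.of_forall fun _ _ => heq
      · obtain ⟨k, hk⟩ := Function.ne_iff.mp heq
        filter_upwards [Filter.eventually_ge_atTop k] with n hn h
        obtain ⟨d, rfl⟩ := Nat.exists_eq_add_of_le hn
        exact absurd (back γ (hT hγ) γ' (hT hγ') d k h) hk
    obtain ⟨n, hn⟩ := hev.exists
    exact Finset.card_le_card_of_injOn (t := Finset.univ) (fun γ => γ n)
      (fun _ _ => Finset.mem_coe.mpr (Finset.mem_univ _)) (fun γ hγ γ' hγ' h => hn γ hγ γ' hγ' h)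
  have hfin : S.Finite := by
    by_contra hinf
    obtain ⟨T, hT, hc'⟩ := Set.Infinite.exists_subset_card_eq hinf (Fintype.card Q + 1)
    have := key T hT
    omega
  refine ⟨hfin, ?_⟩
  rw [Set.ncard_eq_toFinset_card S hfin]
  exact key _ (by simp)
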